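/- arXiv:1411.4471 — 3 statements merged into one kernel-verified Lean document; each statement's English description precedes it below -/
import Mathlib

section
/- Let U be a finite-dimensional complex vector space carrying an irreducible nontrivial representation of sl(2,ℂ), and let A, B ∈ sl(2,ℂ) be nonzero nilpotent elements (A ≠ 0, A² = 0, B ≠ 0, B² = 0 as matrices). Then the kernel of the action of A on U equals the kernel of the action of B on U if and only if B is a complex scalar multiple of A. -/
open LieAlgebra.SpecialLinear Matrix

/-- A traceless `2 × 2` matrix has opposite diagonal entries. -/
lemma sl_two_apply_one_one (X : sl (Fin 2) ℂ) : X.1 1 1 = -X.1 0 0 := by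
  have h : X.1.trace = 0 := LinearMap.mem_ker.mp X.2
  rw [trace_fin_two] at h
  linear_combination h

/-- Two traceless `2 × 2` matrices agree if their first rows and lower left entries agree. -/
lemma sl_two_ext {X Y : sl (Fin 2) ℂ} (h₀₀ : X.1 0 0 = Y.1 0 0) (h₀₁ : X.1 0 1 = Y.1 0 1)
    (h₁₀ : X.1 1 0 = Y.1 1 0) : X = Y := by
  refine Subtype.ext (Matrix.ext fun i j => ?_)
  fin_cases i <;> fin_cases j
  · exact h₀₀
  · exact h₀₁
  · exact h₁₀
  · simp [sl_two_apply_one_one, h₀₀]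

/-- The entries of a square-zero traceless `2 × 2` matrix satisfy the determinant equation. -/
lemma sl_two_det_of_sq_eq_zero {X : sl (Fin 2) ℂ} (hX : X.1 ^ 2 = 0) :
    X.1 0 0 ^ 2 + X.1 0 1 * X.1 1 0 = 0 := by
  have h := congrFun (congrFun hX 0) 0
  simp only [pow_two, mul_apply, Fin.sum_univ_two, Matrix.zero_apply] at h
  linear_combination h

/-- The trace form of two traceless `2 × 2` matrices in coordinates. -/
lemma sl_two_trace_mul (X Y : sl (Fin 2) ℂ) :
    (X.1 * Y.1).trace = 2 * (X.1 0 0 * Y.1 0 0) + X.1 0 1 * Y.1 1 0 + X.1 1 0 * Y.1 0 1 := by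
  simp only [trace_fin_two, mul_apply, Fin.sum_univ_two, sl_two_apply_one_one]
  ring

lemma sl_two_smul_apply (c : ℂ) (X : sl (Fin 2) ℂ) (i j : Fin 2) :
    (c • X).1 i j = c * X.1 i j := rfl

lemma sl_two_neg_apply (X : sl (Fin 2) ℂ) (i j : Fin 2) : (-X).1 i j = -X.1 i j := rfl

lemma sl_two_add_apply (X Y : sl (Fin 2) ℂ) (i j : Fin 2) :
    (X + Y).1 i j = X.1 i j + Y.1 i j := rfl

lemma sl_two_lie_apply (X Y : sl (Fin 2) ℂ) (i j : Fin 2) :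
    (⁅X, Y⁆ : sl (Fin 2) ℂ).1 i j =
      X.1 i 0 * Y.1 0 j + X.1 i 1 * Y.1 1 j - (Y.1 i 0 * X.1 0 j + Y.1 i 1 * X.1 1 j) := by
  rw [sl_bracket, Matrix.sub_apply, mul_apply, mul_apply, Fin.sum_univ_two, Fin.sum_univ_two]

/-- Nilpotent elements of `sl(2,ℂ)` that are orthogonal for the trace form are proportional. -/
lemma sl_two_exists_smul_of_trace_mul_eq_zero {A B : sl (Fin 2) ℂ} (hA : A ≠ 0)
    (hA2 : A.1 ^ 2 = 0) (hB2 : B.1 ^ 2 = 0) (hAB : (A.1 * B.1).trace = 0) :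
    ∃ c : ℂ, B = c • A := by
  have ha := sl_two_det_of_sq_eq_zero hA2
  have hb := sl_two_det_of_sq_eq_zero hB2
  rw [sl_two_trace_mul] at hAB
  have h₁ : A.1 0 1 * B.1 1 0 = A.1 1 0 * B.1 0 1 := by
    rw [← sub_eq_zero]
    apply pow_eq_zero_iff two_ne_zero |>.mp
    grind
  have h₂ : A.1 0 1 * B.1 0 0 = B.1 0 1 * A.1 0 0 := by
    rw [← sub_eq_zero]
    apply pow_eq_zero_iff two_ne_zero |>.mp
    grind
  by_cases h : A.1 0 1 = 0
  · have h₀₀ : A.1 0 0 = 0 := by simpa [h] using ha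
    have h₁₀ : A.1 1 0 ≠ 0 := fun h' => hA (sl_two_ext h₀₀ h h')
    have h₀₁ : B.1 0 1 = 0 := by simpa [h, h₁₀] using h₁
    have hb₀ : B.1 0 0 = 0 := by simpa [h₀₁] using hb
    refine ⟨B.1 1 0 / A.1 1 0, sl_two_ext ?_ ?_ ?_⟩
    · simp [sl_two_smul_apply, hb₀, h₀₀]
    · simp [sl_two_smul_apply, h₀₁, h]
    · simp [sl_two_smul_apply, h₁₀]
  · refine ⟨B.1 0 1 / A.1 0 1, sl_two_ext ?_ ?_ ?_⟩
    · rw [sl_two_smul_apply]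
      field_simp
      linear_combination h₂
    · simp [sl_two_smul_apply, h]
    · rw [sl_two_smul_apply]
      field_simp
      linear_combination h₁

/-- Nilpotent elements of `sl(2,ℂ)` that are not orthogonal for the trace form are, up to scaling,
the nilpotent elements of an `sl₂`-triple. -/
lemma sl_two_isSl2Triple {A B : sl (Fin 2) ℂ} (hA2 : A.1 ^ 2 = 0) (hB2 : B.1 ^ 2 = 0)
    (hAB : (A.1 * B.1).trace ≠ 0) :
    IsSl2Triple ⁅A, (A.1 * B.1).trace⁻¹ • B⁆ A ((A.1 * B.1).trace⁻¹ • B) := by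
  have ha := sl_two_det_of_sq_eq_zero hA2
  have hb := sl_two_det_of_sq_eq_zero hB2
  have hk := sl_two_trace_mul A B
  generalize (A.1 * B.1).trace = k at *
  have hA' : ⁅⁅A, B⁆, A⁆ = (2 * k) • A := by
    apply sl_two_ext <;>
    simp only [sl_two_smul_apply, sl_two_lie_apply, sl_two_apply_one_one] <;>
    grind
  have hB' : ⁅⁅A, B⁆, B⁆ = -((2 * k) • B) := by
    apply sl_two_ext <;>
    simp only [sl_two_smul_apply, sl_two_neg_apply, sl_two_lie_apply, sl_two_apply_one_one] <;>
    grind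
  have hA0 : A ≠ 0 := by
    rintro rfl
    simp at hk
    exact hAB hk
  have hlie : ⁅⁅A, k⁻¹ • B⁆, A⁆ = 2 • A := by
    rw [lie_smul, smul_lie, hA', smul_smul, ← Nat.cast_smul_eq_nsmul ℂ]
    congr 1
    field_simp
    norm_num
  refine ⟨fun h => ?_, rfl, hlie, ?_⟩
  · rw [h, zero_lie, eq_comm, ← Nat.cast_smul_eq_nsmul ℂ] at hlie
    exact hA0 ((smul_eq_zero.mp hlie).resolve_left (by norm_num))
  · rw [lie_smul, lie_smul, smul_lie, hB', smul_neg, smul_neg, smul_smul, smul_smul,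
      ← Nat.cast_smul_eq_nsmul ℂ, smul_smul]
    congr 2
    field_simp
    norm_num

/-- Nilpotent elements of `sl(2,ℂ)` that are not orthogonal for the trace form span `sl(2,ℂ)`
together with their bracket. -/
lemma sl_two_exists_eq_add_lie {A B : sl (Fin 2) ℂ} (hA2 : A.1 ^ 2 = 0) (hB2 : B.1 ^ 2 = 0)
    (hAB : (A.1 * B.1).trace ≠ 0) (X : sl (Fin 2) ℂ) :
    ∃ α β γ : ℂ, X = α • A + β • B + γ • ⁅A, B⁆ := by
  have ha := sl_two_det_of_sq_eq_zero hA2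
  have hb := sl_two_det_of_sq_eq_zero hB2
  have hk := sl_two_trace_mul A B
  have hXA := sl_two_trace_mul X A
  have hXB := sl_two_trace_mul X B
  have hXH := sl_two_trace_mul X ⁅A, B⁆
  refine ⟨(X.1 * B.1).trace / (A.1 * B.1).trace, (X.1 * A.1).trace / (A.1 * B.1).trace,
    (X.1 * (⁅A, B⁆ : sl (Fin 2) ℂ).1).trace / (2 * (A.1 * B.1).trace ^ 2), ?_⟩
  simp only [sl_two_lie_apply, sl_two_apply_one_one] at hXH
  generalize (A.1 * B.1).trace = k at *
  rw [hXA, hXB, hXH]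
  apply sl_two_ext <;>
  simp only [sl_two_smul_apply, sl_two_add_apply, sl_two_lie_apply, sl_two_apply_one_one] <;>
  field_simp <;>
  grind

/-- Let `U` be a finite-dimensional complex vector space carrying an irreducible nontrivial
representation of `sl(2,ℂ)`, and let `A, B ∈ sl(2,ℂ)` be nonzero nilpotent elements.  Then the
kernels of the actions of `A` and `B` on `U` coincide if and only if `B` is a complex scalar
multiple of `A`. -/
theorem ker_action_eq_iff_smul
    (U : Type*) [AddCommGroup U] [Module ℂ U] [FiniteDimensional ℂ U]
    [LieRingModule (LieAlgebra.SpecialLinear.sl (Fin 2) ℂ) U]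
    [LieModule ℂ (LieAlgebra.SpecialLinear.sl (Fin 2) ℂ) U]
    -- the representation is irreducible: `U` is nonzero and its only invariant subspaces
    -- are `0` and `U`
    (hirr : Nontrivial U ∧
      ∀ W : LieSubmodule ℂ (LieAlgebra.SpecialLinear.sl (Fin 2) ℂ) U, W = ⊥ ∨ W = ⊤)
    -- the representation is nontrivial
    (hnt : ¬ LieModule.IsTrivial (LieAlgebra.SpecialLinear.sl (Fin 2) ℂ) U)
    (A B : LieAlgebra.SpecialLinear.sl (Fin 2) ℂ)
    (hA : A ≠ 0) (hA2 : (A : Matrix (Fin 2) (Fin 2) ℂ) ^ 2 = 0)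
    (hB : B ≠ 0) (hB2 : (B : Matrix (Fin 2) (Fin 2) ℂ) ^ 2 = 0) :
    LinearMap.ker (LieModule.toEnd ℂ (LieAlgebra.SpecialLinear.sl (Fin 2) ℂ) U A) =
        LinearMap.ker (LieModule.toEnd ℂ (LieAlgebra.SpecialLinear.sl (Fin 2) ℂ) U B) ↔
      ∃ c : ℂ, B = c • A := by
  constructor
  · intro hker
    by_contra hne
    have hAB : ((A : Matrix (Fin 2) (Fin 2) ℂ) * (B : Matrix (Fin 2) (Fin 2) ℂ)).trace ≠ 0 :=
      fun h => hne (sl_two_exists_smul_of_trace_mul_eq_zero hA hA2 hB2 h)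
    have := hirr.1
    obtain ⟨μ, v, hv, hprim⟩ :=
      (sl_two_isSl2Triple hA2 hB2 hAB).exists_hasPrimitiveVectorWith (R := ℂ) (M := U)
    have hAv : ⁅A, v⁆ = 0 := hprim.lie_e
    have hBv : ⁅B, v⁆ = 0 := by
      have : v ∈ LinearMap.ker (LieModule.toEnd ℂ (sl (Fin 2) ℂ) U A) := hAv
      rwa [hker] at this
    have hmem : v ∈ LieModule.maxTrivSubmodule ℂ (sl (Fin 2) ℂ) U := by
      rw [LieModule.mem_maxTrivSubmodule]
      intro X
      obtain ⟨α, β, γ, rfl⟩ := sl_two_exists_eq_add_lie hA2 hB2 hAB X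
      simp [hAv, hBv]
    rcases hirr.2 (LieModule.maxTrivSubmodule ℂ (sl (Fin 2) ℂ) U) with h | h
    · rw [h, LieSubmodule.mem_bot] at hmem
      exact hv hmem
    · exact hnt ((LieModule.isTrivial_iff_max_triv_eq_top ℂ (sl (Fin 2) ℂ) U).mpr h)
  · rintro ⟨c, rfl⟩
    have hc : c ≠ 0 := fun h => hB (by rw [h, zero_smul])
    rw [map_smul, LinearMap.ker_smul _ c hc]
end

section
/- Let h be a finite-dimensional complex Lie algebra and let μ : h → sl(2,ℂ) be a surjective homomorphism of complex Lie algebras. Then μ admits a Lie algebra section: there exists a homomorphism of complex Lie algebras τ : sl(2,ℂ) → h with μ ∘ τ = id. -/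
open Module

lemma commute_mul_of_weights {R : Type*} [Ring R] {H E F : R}
    (hhe : H * E = E * H + 2 * E) (hhf : H * F = F * H - 2 * F) : Commute H (E * F) := by
  change H * (E * F) = E * F * H
  rw [← mul_assoc, hhe, add_mul, mul_assoc E H F, hhf]
  noncomm_ring

section EndomorphismTriple

variable {𝕜 V : Type*} [Field 𝕜] [AddCommGroup V] [Module 𝕜 V] [FiniteDimensional 𝕜 V]

/-- If the class of `v` modulo a `T`-invariant subspace is an eigenvector of `T`, then this class
contains a generalized eigenvector of `T` with the same eigenvalue. -/
lemma exists_sub_mem_maxGenEigenspace (T : End 𝕜 V) (c : 𝕜) (K : Submodule 𝕜 V)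
    (hK : ∀ w ∈ K, T w ∈ K) {v : V} (hv : T v - c • v ∈ K) :
    ∃ k ∈ K, v - k ∈ T.maxGenEigenspace c := by
  have hS : ∀ w ∈ K, (T - c • (1 : End 𝕜 V)) w ∈ K := fun w hw ↦ by
    simpa using K.sub_mem (hK w hw) (K.smul_mem c hw)
  set S := (T - c • (1 : End 𝕜 V)).restrict hS with hSdef
  have hpow (n : ℕ) (w : K) : ((S ^ n) w : V) = ((T - c • (1 : End 𝕜 V)) ^ n) (w : V) := by
    rw [hSdef, Module.End.pow_restrict]; rfl
  obtain ⟨n, hn, hn1⟩ :=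
    (S.eventually_isCompl_ker_pow_range_pow.and (Filter.eventually_ge_atTop 1)).exists
  obtain ⟨a, ha, b, ⟨w, hw⟩, hab⟩ := Submodule.mem_sup.mp
    (hn.sup_eq_top ▸ Submodule.mem_top :
      (⟨_, hv⟩ : K) ∈ LinearMap.ker (S ^ n) ⊔ LinearMap.range (S ^ n))
  obtain ⟨m, rfl⟩ := Nat.exists_eq_add_of_le' hn1
  refine ⟨(S ^ m) w, Subtype.property _, ?_⟩
  rw [Module.End.mem_maxGenEigenspace]
  refine ⟨m + 1 + 1, ?_⟩
  have key : (T - c • (1 : End 𝕜 V)) (v - (S ^ m) w) = a := by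
    have h1 : T v - c • v = (a : V) + b := congrArg Subtype.val hab.symm
    have h2 : (b : V) = (T - c • (1 : End 𝕜 V)) ((S ^ m) w) := by
      rw [← hw, pow_succ', Module.End.mul_apply]; rfl
    rw [map_sub, ← h2, sub_eq_iff_eq_add, ← h1]
    simp
  rw [pow_succ, Module.End.mul_apply, key, ← hpow, LinearMap.mem_ker.mp ha]
  rfl

variable [CharZero 𝕜] {H E F : End 𝕜 V}

/-- A vector of weight `2` killed by `E F` generates an infinite chain `E ^ n v` of eigenvectors,
so it vanishes in finite dimension. -/
lemma eq_zero_of_apply_apply_eq_zero_of_weight_two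
    (hef : E * F = F * E + H) (hhe : H * E = E * H + 2 * E)
    {v : V} (hv : H v = (2 : 𝕜) • v) (hv' : E (F v) = 0) : v = 0 := by
  have hHE (u : V) : H (E u) = E (H u) + (2 : 𝕜) • E u := by
    have := congr($hhe u)
    simpa [two_mul, two_smul] using this
  have hEF (u : V) : E (F u) = F (E u) + H u := congr($hef u)
  have weight (n : ℕ) : H ((E ^ n) v) = (2 + 2 * n : 𝕜) • (E ^ n) v := by
    induction n with
    | zero => simpa using hv
    | succ n ih =>
      rw [pow_succ', Module.End.mul_apply, hHE, ih, map_smul, ← add_smul]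
      push_cast
      ring_nf
  have lower (n : ℕ) : F ((E ^ (n + 1)) v) = (-((n + 1) * (n + 2)) : 𝕜) • (E ^ n) v := by
    induction n with
    | zero =>
      have := hEF v
      rw [hv', hv] at this
      simpa using eq_neg_of_add_eq_zero_left this.symm
    | succ n ih =>
      have := hEF ((E ^ (n + 1)) v)
      rw [ih, weight, map_smul, ← Module.End.mul_apply E, ← Module.End.mul_apply E, ← pow_succ',
        ← pow_succ', ← sub_eq_iff_eq_add, ← sub_smul] at this
      rw [← this]
      push_cast
      ring_nf
  by_contra hne
  have nonzero (n : ℕ) : (E ^ n) v ≠ 0 := by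
    induction n with
    | zero => simpa using hne
    | succ n ih =>
      intro h0
      have := lower n
      rw [h0, map_zero, eq_comm, smul_eq_zero, neg_eq_zero] at this
      refine this.elim (fun h ↦ ?_) ih
      norm_cast at h
  have := (Module.End.eigenvectors_linearIndependent' H (fun n : ℕ ↦ (2 + 2 * n : 𝕜))
    (fun a b hab ↦ by simpa using hab) (fun n ↦ (E ^ n) v)
    (fun n ↦ ⟨Module.End.mem_eigenspace_iff.mpr (weight n), nonzero n⟩)).finite
  exact not_finite ℕ

lemma eq_zero_of_mem_maxGenEigenspace_two
    (hef : E * F = F * E + H) (hhe : H * E = E * H + 2 * E) (hhf : H * F = F * H - 2 * F)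
    (c : 𝕜) {v : V} (hv : v ∈ H.maxGenEigenspace 2)
    (hv' : c • (H v - (2 : 𝕜) • v) + E (F v) = 0) : v = 0 := by
  set S : End 𝕜 V := H - (2 : 𝕜) • 1 with hS
  have hcomm : Commute S (c • S + E * F) := by
    refine (Commute.smul_right rfl c).add_right ?_
    exact (commute_mul_of_weights hhe hhf).sub_left ((Commute.one_left _).smul_left _)
  by_contra hne
  obtain ⟨n, hn⟩ := (Module.End.mem_maxGenEigenspace _ _ _).mp hv
  obtain ⟨m, hm, hm'⟩ := Nat.exists_not_and_succ_of_not_zero_of_exists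
    (p := fun n ↦ (S ^ n) v = 0) (by simpa using hne) ⟨n, hn⟩
  have hw : S ((S ^ m) v) = 0 := by rwa [← Module.End.mul_apply, ← pow_succ']
  have hw' : (c • S + E * F) ((S ^ m) v) = 0 := by
    rw [← Module.End.mul_apply, ← (hcomm.pow_left m).eq, Module.End.mul_apply]
    have : (c • S + E * F) v = 0 := by simpa [hS] using hv'
    rw [this, map_zero]
  refine hm (eq_zero_of_apply_apply_eq_zero_of_weight_two hef hhe ?_ ?_)
  · simpa [hS, sub_eq_zero] using hw
  · simpa [hw] using hw'

/-- The cohomological core of the lifting argument: the vanishing of the obstruction class in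
weights `2` and `-2`. -/
lemma exists_correction_of_apply_eq_apply
    (hef : E * F = F * E + H) (hhe : H * E = E * H + 2 * E) (hhf : H * F = F * H - 2 * F)
    {a b : V} (ha : a ∈ H.maxGenEigenspace 2) (hb : b ∈ H.maxGenEigenspace (-2))
    (hab : F a = E b) :
    ∃ k, a + (H k - (2 : 𝕜) • k + E (F k)) = 0 ∧ b + F (F k) = 0 := by
  set W := H.maxGenEigenspace 2
  have hcomm : Commute H (H - (2 : 𝕜) • 1 + E * F) := by
    exact ((Commute.refl H).sub_right ((Commute.one_right _).smul_right _)).add_right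
      (commute_mul_of_weights hhe hhf)
  have hW := Module.End.mapsTo_maxGenEigenspace_of_comm hcomm 2
  have hinj : Function.Injective ((H - (2 : 𝕜) • 1 + E * F).restrict hW) := by
    refine (injective_iff_map_eq_zero _).mpr fun v hv ↦ Subtype.ext ?_
    refine eq_zero_of_mem_maxGenEigenspace_two hef hhe hhf 1 v.2 ?_
    rw [one_smul]
    exact congrArg Subtype.val hv
  obtain ⟨⟨k, hk⟩, hka⟩ := LinearMap.injective_iff_surjective.mp hinj ⟨-a, W.neg_mem ha⟩
  have hka' : H k - (2 : 𝕜) • k + E (F k) = -a := congrArg Subtype.val hka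
  refine ⟨k, by rw [hka', add_neg_cancel], ?_⟩
  have hHF (u : V) : H (F u) = F (H u) - (2 : 𝕜) • F u := by
    have := congr($hhf u)
    simpa [two_mul, two_smul] using this
  have hEF (u : V) : E (F u) = F (E u) + H u := congr($hef u)
  have hE : E (b + F (F k)) = 0 := by
    have h1 : a = -(H k - (2 : 𝕜) • k + E (F k)) := by rw [hka', neg_neg]
    rw [map_add, ← hab, h1, hEF (F k), hHF]
    simp only [map_neg, map_add, map_sub, map_smul]
    abel
  have hFF : F (F k) ∈ H.maxGenEigenspace (-2) := by
    obtain ⟨n, hn⟩ := (Module.End.mem_maxGenEigenspace _ _ _).mp hk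
    refine (Module.End.mem_maxGenEigenspace _ _ _).mpr ⟨n, ?_⟩
    have hsc : SemiconjBy (F * F) (H - (2 : 𝕜) • 1) (H - (-2 : 𝕜) • 1) := by
      ext u
      simp [hHF]
    have := congr($((hsc.pow_right n).eq) k)
    simp only [Module.End.mul_apply] at this
    rw [← this, hn, map_zero, map_zero]
  have hmem : b + F (F k) ∈ (-H).maxGenEigenspace 2 := by
    obtain ⟨n, hn⟩ := (Module.End.mem_maxGenEigenspace _ _ _).mp (add_mem hb hFF)
    refine (Module.End.mem_maxGenEigenspace _ _ _).mpr ⟨n, ?_⟩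
    have : -H - (2 : 𝕜) • 1 = -(H - (-2 : 𝕜) • (1 : End 𝕜 V)) := by module
    rw [this, neg_pow, Module.End.mul_apply, hn, map_zero]
  refine eq_zero_of_mem_maxGenEigenspace_two (H := -H) (E := F) (F := E) ?_ ?_ ?_ 0 hmem ?_
  · rw [hef]; abel
  · rw [neg_mul, hhf]; noncomm_ring
  · rw [neg_mul, hhe]; noncomm_ring
  · simp [hE]

end EndomorphismTriple

/-- The homomorphism induced on the quotient by an ideal contained in the kernel. -/
lemma LieHom.exists_quotient_lift {𝕜 g L : Type*} [CommRing 𝕜] [LieRing L] [LieAlgebra 𝕜 L]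
    [LieRing g] [LieAlgebra 𝕜 g] (μ : g →ₗ⁅𝕜⁆ L)
    (I : LieIdeal 𝕜 g) (hI : I ≤ μ.ker) :
    ∃ ν : g ⧸ I →ₗ⁅𝕜⁆ L, ∀ z : g, ν (LieSubmodule.Quotient.mk z) = μ z := by
  refine ⟨{ Submodule.liftQ I.toSubmodule (μ : g →ₗ[𝕜] L) (fun z hz ↦ hI hz) with
    map_lie' := ?_ }, fun z ↦ rfl⟩
  rintro ⟨y⟩ ⟨z⟩
  exact μ.map_lie y z

/-- A nonzero solvable ideal is strictly larger than its derived ideal. -/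
lemma LieIdeal.lie_self_ne_self_of_isSolvable {𝕜 g : Type*} [CommRing 𝕜] [LieRing g]
    [LieAlgebra 𝕜 g] (I : LieIdeal 𝕜 g) [LieAlgebra.IsSolvable I] (hI : I ≠ ⊥) : ⁅I, I⁆ ≠ I := by
  intro h
  obtain ⟨k, hk⟩ := LieAlgebra.IsSolvable.solvable 𝕜 I
  rw [LieIdeal.derivedSeries_eq_bot_iff] at hk
  have (n : ℕ) : LieAlgebra.derivedSeriesOfIdeal 𝕜 g n I = I := by
    induction n with
    | zero => rfl
    | succ n ih => rw [LieAlgebra.derivedSeriesOfIdeal_succ, ih, h]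
  exact hI (this k ▸ hk)

section Lifting

variable {𝕜 L : Type*} [Field 𝕜] [CharZero 𝕜] [LieRing L] [LieAlgebra 𝕜 L] {H E F : L}

open LieAlgebra

/-- An `sl₂` triple lifts along a homomorphism with abelian kernel. -/
lemma IsSl2Triple.exists_lift_of_abelian_ker (t : IsSl2Triple H E F)
    {g : Type*} [LieRing g] [LieAlgebra 𝕜 g] [FiniteDimensional 𝕜 g] (μ : g →ₗ⁅𝕜⁆ L)
    (hK : ∀ k l : g, μ k = 0 → μ l = 0 → ⁅k, l⁆ = 0)
    (hE : E ∈ Set.range μ) (hF : F ∈ Set.range μ) :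
    ∃ x e f : g, IsSl2Triple x e f ∧ μ e = E ∧ μ f = F := by
  obtain ⟨e₀, he₀⟩ := hE
  obtain ⟨f₀, hf₀⟩ := hF
  set x₀ := ⁅e₀, f₀⁆ with hx₀
  have hμx₀ : μ x₀ = H := by rw [hx₀, LieHom.map_lie, he₀, hf₀, t.lie_e_f]
  set K : Submodule 𝕜 g := LinearMap.ker (μ : g →ₗ[𝕜] L)
  have memK {z : g} : z ∈ K ↔ μ z = 0 := Iff.rfl
  have adK (y : g) : ∀ w ∈ K, ad 𝕜 g y w ∈ K := fun w hw ↦ by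
    rw [memK] at hw ⊢
    rw [ad_apply, LieHom.map_lie, hw, lie_zero]
  obtain ⟨k₁, hk₁, he⟩ := exists_sub_mem_maxGenEigenspace (ad 𝕜 g x₀) 2 K (adK x₀) (v := e₀) (by
    rw [memK, ad_apply, map_sub, LieHom.map_lie, hμx₀, map_smul, he₀, t.lie_h_e_smul 𝕜, sub_self])
  obtain ⟨k₂, hk₂, hf⟩ := exists_sub_mem_maxGenEigenspace (ad 𝕜 g x₀) (-2) K (adK x₀) (v := f₀) (by
    rw [memK, ad_apply, map_sub, LieHom.map_lie, hμx₀, map_smul, hf₀, t.lie_lie_smul_f 𝕜, neg_smul,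
      sub_self])
  rw [memK] at hk₁ hk₂
  set e := e₀ - k₁ with hedef
  set f := f₀ - k₂ with hfdef
  have hμe : μ e = E := by rw [hedef, map_sub, hk₁, he₀, sub_zero]
  have hμf : μ f = F := by rw [hfdef, map_sub, hk₂, hf₀, sub_zero]
  clear_value e f
  set x := ⁅e, f⁆ with hx
  have hμx : μ x = H := by rw [hx, LieHom.map_lie, hμe, hμf, t.lie_e_f]
  have hxmem : x ∈ (ad 𝕜 g x₀).maxGenEigenspace 0 := by
    have := LieModule.lie_mem_maxGenEigenspace_toEnd (R := 𝕜) (L := g) (M := g) he hf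
    rwa [add_neg_cancel] at this
  set a := ⁅x, e⁆ - (2 : 𝕜) • e with ha
  set b := ⁅x, f⁆ + (2 : 𝕜) • f with hb
  have haK : a ∈ K := by
    rw [memK, ha, map_sub, LieHom.map_lie, hμx, map_smul, hμe, t.lie_h_e_smul 𝕜, sub_self]
  have hbK : b ∈ K := by
    rw [memK, hb, map_add, LieHom.map_lie, hμx, map_smul, hμf, t.lie_lie_smul_f 𝕜, neg_add_cancel]
  have hamem : a ∈ (ad 𝕜 g x₀).maxGenEigenspace 2 := by
    have := LieModule.lie_mem_maxGenEigenspace_toEnd (R := 𝕜) (L := g) (M := g) hxmem he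
    rw [zero_add] at this
    exact sub_mem this (Submodule.smul_mem _ _ he)
  have hbmem : b ∈ (ad 𝕜 g x₀).maxGenEigenspace (-2) := by
    have := LieModule.lie_mem_maxGenEigenspace_toEnd (R := 𝕜) (L := g) (M := g) hxmem hf
    rw [zero_add] at this
    exact add_mem this (Submodule.smul_mem _ _ hf)
  have memRestrict {c : 𝕜} {z : g} (hz : z ∈ K) (h : z ∈ (ad 𝕜 g x₀).maxGenEigenspace c) :
      (⟨z, hz⟩ : K) ∈ End.maxGenEigenspace ((ad 𝕜 g x₀).restrict (adK x₀)) c := by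
    rw [End.maxGenEigenspace, End.genEigenspace_restrict]
    exact h
  have hxx₀ {k : g} (hk : μ k = 0) : ⁅x₀, k⁆ = ⁅x, k⁆ := by
    rw [← sub_eq_zero, ← sub_lie]
    exact hK _ _ (by rw [map_sub, hμx, hμx₀, sub_self]) hk
  have hxe : ⁅x, e⁆ = a + (2 : 𝕜) • e := by rw [ha]; abel
  have hxf : ⁅x, f⁆ = b - (2 : 𝕜) • f := by rw [hb]; abel
  clear_value a b
  have hjac : ⁅f, a⁆ = ⁅e, b⁆ := by
    have h1 := leibniz_lie x e f
    rw [← hx, lie_self, hxe, hxf, add_lie, lie_sub, smul_lie, lie_smul, ← lie_skew a f] at h1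
    rw [eq_comm, ← sub_eq_zero, h1]
    abel
  have lieK {y k : g} (hk : μ k = 0) : μ ⁅y, k⁆ = 0 := by rw [LieHom.map_lie, hk, lie_zero]
  obtain ⟨⟨k, hk⟩, hka, hkb⟩ := exists_correction_of_apply_eq_apply
    (H := (ad 𝕜 g x₀).restrict (adK x₀)) (E := (ad 𝕜 g e).restrict (adK e))
    (F := (ad 𝕜 g f).restrict (adK f))
    (by
      ext ⟨k, hk⟩
      change ⁅e, ⁅f, k⁆⁆ = ⁅f, ⁅e, k⁆⁆ + ⁅x₀, k⁆
      rw [hxx₀ hk, hx, lie_lie]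
      abel)
    (by
      rw [two_mul]
      ext ⟨k, hk⟩
      change ⁅x₀, ⁅e, k⁆⁆ = ⁅e, ⁅x₀, k⁆⁆ + (⁅e, k⁆ + ⁅e, k⁆)
      rw [hxx₀ hk, hxx₀ (lieK hk), leibniz_lie x, hxe, add_lie, hK a k haK hk, smul_lie, two_smul]
      abel)
    (by
      rw [two_mul]
      ext ⟨k, hk⟩
      change ⁅x₀, ⁅f, k⁆⁆ = ⁅f, ⁅x₀, k⁆⁆ - (⁅f, k⁆ + ⁅f, k⁆)
      rw [hxx₀ hk, hxx₀ (lieK hk), leibniz_lie x, hxf, sub_lie, hK b k hbK hk, smul_lie, two_smul]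
      abel)
    (memRestrict haK hamem) (memRestrict hbK hbmem) (Subtype.ext hjac)
  replace hka : a + (⁅x₀, k⁆ - (2 : 𝕜) • k + ⁅e, ⁅f, k⁆⁆) = 0 := congrArg Subtype.val hka
  replace hkb : b + ⁅f, ⁅f, k⁆⁆ = 0 := congrArg Subtype.val hkb
  rw [hxx₀ hk] at hka
  have hμe' : μ (e + k) = E := by rw [map_add, memK.mp hk, hμe, add_zero]
  have hx' : ⁅e + k, f⁆ = x - ⁅f, k⁆ := by rw [add_lie, ← lie_skew k f]; abel
  refine ⟨⁅e + k, f⁆, e + k, f, ⟨fun h0 ↦ t.h_ne_zero ?_, rfl, ?_, ?_⟩, hμe', hμf⟩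
  · rw [← t.lie_e_f, ← hμe', ← hμf, ← LieHom.map_lie, h0, map_zero]
  · rw [hx', sub_lie, lie_add, lie_add, hxe, hK _ k (lieK hk) hk, add_zero,
      ← lie_skew ⁅f, k⁆ e, ← sub_eq_zero, ← hka]
    module
  · rw [hx', sub_lie, hxf, ← lie_skew ⁅f, k⁆ f, ← sub_eq_zero, ← hkb]
    module

lemma IsSl2Triple.eq_zero_of_smul_add_smul_add_smul_eq_zero (t : IsSl2Triple H E F)
    {a b c : 𝕜} (h : a • E + b • F + c • H = 0) : a = 0 ∧ b = 0 ∧ c = 0 := by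
  have hEH : ⁅E, H⁆ = -((2 : 𝕜) • E) := by rw [← lie_skew, t.lie_h_e_smul 𝕜]
  have hFH : ⁅F, H⁆ = (2 : 𝕜) • F := by rw [← lie_skew, t.lie_lie_smul_f 𝕜, neg_neg]
  have hFE : ⁅F, E⁆ = -H := by rw [← lie_skew, t.lie_e_f]
  have hb : b = 0 := by
    have := congr(⁅E, ⁅E, $h⁆⁆)
    simpa [t.lie_e_f, hEH, t.e_ne_zero] using this
  have ha : a = 0 := by
    have := congr(⁅F, ⁅F, $h⁆⁆)
    simpa [hFE, hFH, t.f_ne_zero] using this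
  exact ⟨ha, hb, by simpa [ha, hb, t.h_ne_zero] using h⟩

/-- An `sl₂` triple lifts along any homomorphism from a finite-dimensional Lie algebra whose
range contains it. -/
theorem IsSl2Triple.exists_lift (t : IsSl2Triple H E F)
    {g : Type*} [LieRing g] [LieAlgebra 𝕜 g] [FiniteDimensional 𝕜 g] (μ : g →ₗ⁅𝕜⁆ L)
    (hE : E ∈ Set.range μ) (hF : F ∈ Set.range μ) :
    ∃ x e f : g, IsSl2Triple x e f ∧ μ e = E ∧ μ f = F := by
  induction hd : finrank 𝕜 g using Nat.strong_induction_on generalizing g with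
  | _ d ih =>
  subst hd
  have lift_of_subalgebra (p : LieSubalgebra 𝕜 g) (hp : p ≠ ⊤)
      (hEp : ∃ e ∈ p, μ e = E) (hFp : ∃ f ∈ p, μ f = F) :
      ∃ x e f : g, IsSl2Triple x e f ∧ μ e = E ∧ μ f = F := by
    obtain ⟨e, hep, he⟩ := hEp
    obtain ⟨f, hfp, hf⟩ := hFp
    have hlt : finrank 𝕜 p < finrank 𝕜 g :=
      Submodule.finrank_lt (s := p.toSubmodule) fun h ↦ hp (by simpa using h)
    obtain ⟨x', e', f', t', he', hf'⟩ :=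
      ih _ hlt (μ.comp p.incl) ⟨⟨e, hep⟩, he⟩ ⟨⟨f, hfp⟩, hf⟩ rfl
    refine ⟨x', e', f', ⟨?_, ?_, ?_, ?_⟩, he', hf'⟩
    · simpa using t'.h_ne_zero
    · simpa using congrArg Subtype.val t'.lie_e_f
    · simpa using congrArg Subtype.val t'.lie_h_e_nsmul
    · simpa using congrArg Subtype.val t'.lie_h_f_nsmul
  obtain ⟨e₀, he₀⟩ := hE
  obtain ⟨f₀, hf₀⟩ := hF
  by_cases hengel : ∃ y ∈ μ.ker, LieSubalgebra.engel 𝕜 y ≠ ⊤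
  · obtain ⟨y, hy, hne⟩ := hengel
    rw [LieHom.mem_ker] at hy
    have lift_mem (v : g) : ∃ w ∈ LieSubalgebra.engel 𝕜 y, μ w = μ v := by
      obtain ⟨k, hk, hmem⟩ := exists_sub_mem_maxGenEigenspace (ad 𝕜 g y) 0
        μ.ker.toSubmodule (fun w _ ↦ by simp [hy]) (v := v) (by simp [hy])
      have hk' : μ k = 0 := by simpa using hk
      exact ⟨v - k, hmem, by rw [map_sub, hk', sub_zero]⟩
    exact lift_of_subalgebra _ hne (he₀ ▸ lift_mem e₀) (hf₀ ▸ lift_mem f₀)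
  push Not at hengel
  have hnil : LieRing.IsNilpotent μ.ker := by
    rw [LieAlgebra.isNilpotent_iff_forall (R := 𝕜)]
    intro y
    have hy : ∀ z : g, ∃ n : ℕ, (ad 𝕜 g y ^ n) z = 0 := fun z ↦
      (LieSubalgebra.mem_engel_iff 𝕜 _ _).mp (hengel y y.2 ▸ LieSubalgebra.mem_top z)
    exact LieSubalgebra.isNilpotent_ad_of_isNilpotent_ad (μ.ker : LieSubalgebra 𝕜 g) (x := y)
      (Module.End.isNilpotent_iff_of_finite.mpr hy)
  by_cases hab : ⁅μ.ker, μ.ker⁆ = ⊥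
  · refine t.exists_lift_of_abelian_ker μ (fun k l hk hl ↦ ?_) ⟨e₀, he₀⟩ ⟨f₀, hf₀⟩
    have := LieSubmodule.lie_mem_lie (μ.mem_ker.mpr hk) (μ.mem_ker.mpr hl)
    rwa [hab, LieSubmodule.mem_bot] at this
  set I : LieIdeal 𝕜 g := ⁅μ.ker, μ.ker⁆ with hI
  have hle : I ≤ μ.ker := LieSubmodule.lie_le_right _ _
  obtain ⟨ν, hν⟩ := μ.exists_quotient_lift I hle
  have hlt : finrank 𝕜 (g ⧸ I) < finrank 𝕜 g := by
    have h1 := I.toSubmodule.finrank_quotient_add_finrank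
    have h2 : 0 < finrank 𝕜 I.toSubmodule := by
      rw [Module.finrank_pos_iff, Submodule.nontrivial_iff_ne_bot]
      simpa using hab
    change finrank 𝕜 (g ⧸ I.toSubmodule) < _
    omega
  obtain ⟨x', e', f', t', he', hf'⟩ := ih _ hlt ν
    ⟨LieSubmodule.Quotient.mk e₀, (hν _).trans he₀⟩
    ⟨LieSubmodule.Quotient.mk f₀, (hν _).trans hf₀⟩ rfl
  let p : LieSubalgebra 𝕜 g :=
    { (t'.toLieSubalgebra 𝕜).toSubmodule.comap I.toSubmodule.mkQ with
      lie_mem' := fun hy hz ↦ (t'.toLieSubalgebra 𝕜).lie_mem hy hz }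
  have memp (z : g) : z ∈ p ↔ LieSubmodule.Quotient.mk z ∈ t'.toLieSubalgebra 𝕜 := Iff.rfl
  have lift_mem (w : g ⧸ I) (hw : w ∈ t'.toLieSubalgebra 𝕜) : ∃ z ∈ p, μ z = ν w := by
    obtain ⟨z, rfl⟩ := LieSubmodule.Quotient.surjective_mk' I w
    exact ⟨z, hw, (hν z).symm⟩
  refine lift_of_subalgebra p (fun hp ↦ ?_)
    (he' ▸ lift_mem e' (Submodule.subset_span (by simp)))
    (hf' ▸ lift_mem f' (Submodule.subset_span (by simp)))
  refine μ.ker.lie_self_ne_self_of_isSolvable (fun h0 ↦ hab (by simp [h0, hI])) ?_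
  refine le_antisymm hle fun k hk ↦ ?_
  obtain ⟨a, b, c, habc⟩ :=
    mem_toLieSubalgebra_iff.mp ((memp k).mp (hp ▸ LieSubalgebra.mem_top k))
  have hzero : a • E + b • F + c • H = 0 := by
    rw [← t.lie_e_f, ← he', ← hf', ← LieHom.map_lie, ← map_smul, ← map_smul, ← map_smul, ← map_add,
      ← map_add, ← habc, hν]
    exact μ.mem_ker.mp hk
  obtain ⟨rfl, rfl, rfl⟩ := t.eq_zero_of_smul_add_smul_add_smul_eq_zero hzero
  rw [zero_smul, zero_smul, zero_smul, add_zero, add_zero] at habc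
  exact LieSubmodule.Quotient.mk_eq_zero'.mp habc

end Lifting

/-- A surjective homomorphism of complex Lie algebras from a finite-dimensional complex Lie
algebra onto `sl(2,ℂ)` admits a Lie algebra section. -/
theorem exists_lie_section_of_surjective_onto_sl2
    (h : Type*) [LieRing h] [LieAlgebra ℂ h] [FiniteDimensional ℂ h]
    (μ : h →ₗ⁅ℂ⁆ (LieAlgebra.SpecialLinear.sl (Fin 2) ℂ))
    (hμ : Function.Surjective μ) :
    ∃ τ : (LieAlgebra.SpecialLinear.sl (Fin 2) ℂ) →ₗ⁅ℂ⁆ h,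
      μ.comp τ = LieHom.id := by
  have trace_zero (A : LieAlgebra.SpecialLinear.sl (Fin 2) ℂ) : A.val 1 1 = -A.val 0 0 := by
    have : A.val.trace = 0 := A.2
    rw [Matrix.trace_fin_two] at this
    linear_combination this
  have mem_sl {A : Matrix (Fin 2) (Fin 2) ℂ} (hA : A.trace = 0) :
      A ∈ LieAlgebra.SpecialLinear.sl (Fin 2) ℂ := hA
  let E : LieAlgebra.SpecialLinear.sl (Fin 2) ℂ :=
    ⟨!![0, 1; 0, 0], mem_sl (by simp [Matrix.trace_fin_two])⟩
  let F : LieAlgebra.SpecialLinear.sl (Fin 2) ℂ :=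
    ⟨!![0, 0; 1, 0], mem_sl (by simp [Matrix.trace_fin_two])⟩
  let H : LieAlgebra.SpecialLinear.sl (Fin 2) ℂ :=
    ⟨!![1, 0; 0, -1], mem_sl (by simp [Matrix.trace_fin_two])⟩
  have t : IsSl2Triple H E F := by
    refine ⟨fun h0 ↦ ?_, Subtype.ext ?_, Subtype.ext ?_, Subtype.ext ?_⟩
    · have := congrFun₂ (congrArg Subtype.val h0) 0 0
      simp [H] at this
    · rw [LieAlgebra.SpecialLinear.sl_bracket]
      ext i j
      fin_cases i <;> fin_cases j <;> simp [H, E, F]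
    · rw [LieAlgebra.SpecialLinear.sl_bracket, two_smul]
      ext i j
      fin_cases i <;> fin_cases j <;> simp [H, E]
    · rw [LieAlgebra.SpecialLinear.sl_bracket, two_smul]
      ext i j
      fin_cases i <;> fin_cases j <;> simp [H, F]
      norm_num
  obtain ⟨x, e, f, t', he, hf⟩ := t.exists_lift μ (hμ E) (hμ F)
  have hx : μ x = H := by rw [← t'.lie_e_f, LieHom.map_lie, he, hf, t.lie_e_f]
  let τ : LieAlgebra.SpecialLinear.sl (Fin 2) ℂ →ₗ[ℂ] h :=
    { toFun A := A.val 0 1 • e + A.val 1 0 • f + A.val 0 0 • x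
      map_add' A B := by
        change (A.val 0 1 + B.val 0 1) • e + (A.val 1 0 + B.val 1 0) • f
          + (A.val 0 0 + B.val 0 0) • x = _
        module
      map_smul' c A := by
        change (c * A.val 0 1) • e + (c * A.val 1 0) • f + (c * A.val 0 0) • x = c • _
        module }
  have hτ (A : LieAlgebra.SpecialLinear.sl (Fin 2) ℂ) :
    τ A = A.val 0 1 • e + A.val 1 0 • f + A.val 0 0 • x := rfl
  refine ⟨{ τ with map_lie' := fun {A B} ↦ ?_ }, ?_⟩
  · change τ ⁅A, B⁆ = ⁅τ A, τ B⁆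
    have hef := t'.lie_e_f
    have hfe : ⁅f, e⁆ = -x := by rw [← lie_skew, hef]
    have hxe := t'.lie_h_e_smul ℂ
    have hxf := t'.lie_lie_smul_f ℂ
    have hex : ⁅e, x⁆ = -((2 : ℂ) • e) := by rw [← lie_skew, hxe]
    have hfx : ⁅f, x⁆ = (2 : ℂ) • f := by rw [← lie_skew, hxf, neg_neg]
    simp only [hτ, LieAlgebra.SpecialLinear.sl_bracket, Matrix.sub_apply, Matrix.mul_apply,
      Fin.sum_univ_two, trace_zero, add_lie, lie_add, smul_lie, lie_smul, hef, hfe, hxe, hxf, hex, hfx,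
      lie_self]
    module
  · ext1 A
    change μ (τ A) = A
    rw [hτ, map_add, map_add, map_smul, map_smul, map_smul, he, hf, hx]
    apply Subtype.ext
    ext i j
    fin_cases i <;> fin_cases j <;> simp [E, F, H, trace_zero]
end

section
/- Let E be a real vector space, let J : E → E be a linear complex structure (J ∘ J = −id), and let ρ : E → U be a real linear map such that (ker ρ) ∩ J(ker ρ) = {0}. Then the complexified map ρ^ℂ : E^ℂ → U^ℂ (where E^ℂ = ℂ ⊗_ℝ E) is injective on the eigenspace ker(J^ℂ + i·id) of the complexified endomorphism J^ℂ; equivalently, ker(ρ^ℂ) ∩ ker(J^ℂ + i·id) = {0}. -/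
open TensorProduct

/-- Every element of the complexification has the form `1 ⊗ x + i ⊗ y`. -/
lemma exists_one_tmul_add_I_tmul {E : Type*} [AddCommGroup E] [Module ℝ E] (z : ℂ ⊗[ℝ] E) :
    ∃ x y : E, z = (1 : ℂ) ⊗ₜ[ℝ] x + Complex.I ⊗ₜ[ℝ] y := by
  induction z with
  | zero => exact ⟨0, 0, by simp⟩
  | tmul c e =>
    refine ⟨c.re • e, c.im • e, ?_⟩
    rw [← TensorProduct.smul_tmul, ← TensorProduct.smul_tmul, ← TensorProduct.add_tmul]
    congr 1
    simp [Complex.re_add_im]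
  | add z w hz hw =>
    obtain ⟨x, y, rfl⟩ := hz
    obtain ⟨x', y', rfl⟩ := hw
    refine ⟨x + x', y + y', ?_⟩
    simp only [TensorProduct.tmul_add]
    abel

/-- The real and imaginary parts of an element of the complexification are unique. -/
lemma one_tmul_add_I_tmul_eq_zero_iff {E : Type*} [AddCommGroup E] [Module ℝ E] {x y : E} :
    (1 : ℂ) ⊗ₜ[ℝ] x + Complex.I ⊗ₜ[ℝ] y = 0 ↔ x = 0 ∧ y = 0 := by
  refine ⟨fun h => ⟨?_, ?_⟩, fun ⟨hx, hy⟩ => by simp [hx, hy]⟩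
  · simpa using congrArg (TensorProduct.lid ℝ E ∘ Complex.reLm.rTensor E) h
  · simpa using congrArg (TensorProduct.lid ℝ E ∘ Complex.imLm.rTensor E) h

/-- Let `E` be a real vector space with a linear complex structure `J` and let `ρ : E → U`
be a real linear map with `(ker ρ) ∩ J(ker ρ) = {0}`.  Then the complexified map
`ρ^ℂ : ℂ ⊗ E → ℂ ⊗ U` is injective on the eigenspace `ker(J^ℂ + i·id)`, i.e.
`ker(ρ^ℂ) ⊓ ker(J^ℂ + i·id) = ⊥`. -/
theorem baseChange_injective_on_antiholomorphic_eigenspace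
    {E U : Type*} [AddCommGroup E] [Module ℝ E] [AddCommGroup U] [Module ℝ U]
    (J : E →ₗ[ℝ] E) (hJ : J ∘ₗ J = -LinearMap.id)
    (ρ : E →ₗ[ℝ] U)
    (hker : LinearMap.ker ρ ⊓ (LinearMap.ker ρ).map J = ⊥) :
    LinearMap.ker (ρ.baseChange ℂ) ⊓
        LinearMap.ker (J.baseChange ℂ +
          Complex.I • (LinearMap.id : ℂ ⊗[ℝ] E →ₗ[ℂ] ℂ ⊗[ℝ] E)) = ⊥ := by
  rw [eq_bot_iff]
  rintro z ⟨hρz, hJz⟩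
  obtain ⟨x, y, rfl⟩ := exists_one_tmul_add_I_tmul z
  obtain ⟨hρx, hρy⟩ : ρ x = 0 ∧ ρ y = 0 := by
    rw [← one_tmul_add_I_tmul_eq_zero_iff]
    simpa using hρz
  obtain ⟨hJx, hJy⟩ : J x - y = 0 ∧ J y + x = 0 := by
    rw [← one_tmul_add_I_tmul_eq_zero_iff, ← LinearMap.mem_ker.mp hJz]
    simp only [LinearMap.add_apply, LinearMap.smul_apply, LinearMap.id_apply, map_add,
      LinearMap.baseChange_tmul, TensorProduct.smul_tmul', smul_eq_mul, mul_one,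
      Complex.I_mul_I, TensorProduct.neg_tmul, TensorProduct.tmul_add, TensorProduct.tmul_sub]
    abel
  have hy : y = 0 := by
    rw [← Submodule.mem_bot ℝ, ← hker]
    exact ⟨hρy, x, hρx, sub_eq_zero.mp hJx⟩
  have hx : x = 0 := by simpa [hy] using hJy
  simp [hx, hy]
end
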